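/- For all real constants c > 0 and ε with 0 < ε < 2, and for every natural number k, there exists N such that for all n ≥ N the following holds: for every nonempty finite set X, every row-stochastic matrix P : X × X → ℝ with stationary probability distribution π, and every function ξ : X → (finite sets of edges of the complete graph K on 2n vertices) with |ξ(x)| ≤ c·(2n)^{2−ε} for all x ∈ X, there exists a perfect matching M of K such that the expected hitting time τ of the set Y = {x ∈ X : M ⊆ ξ(x)}, for the chain P started from π, satisfies τ ≥ n^k. -/

import Mathlib

open scoped ENNReal

/-- `M` is a perfect matching of the simple graph `G`: every element of `M` is an
edge of `G`, and every vertex is incident to exactly one edge of `M`. -/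
def IsPerfectMatchingOn {V : Type*} (G : SimpleGraph V) (M : Finset (Sym2 V)) : Prop :=
  (∀ e ∈ M, e ∈ G.edgeSet) ∧ ∀ v : V, ∃! e, e ∈ M ∧ v ∈ e

/-- The first-hitting distribution of a set `Y ⊆ X`, for a Markov chain with
transition matrix `P` started from the initial distribution `π`:
`f 0 = Σ_{x ∈ Y} π x`, and for `i ≥ 1`, `f i` is the sum, over all sequences
`x_0, x_1, …, x_i` of elements of `X` with `x_0, …, x_{i-1} ∉ Y` and `x_i ∈ Y`,
of `π x_0 · ∏_{j=0}^{i-1} P (x_j) (x_{j+1})`. -/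
noncomputable def hitDist {X : Type*} [Fintype X] [DecidableEq X]
    (P : X → X → ℝ) (π : X → ℝ) (Y : Finset X) : ℕ → ℝ
  | 0 => ∑ x ∈ Y, π x
  | (i + 1) =>
      ∑ x ∈ Finset.univ.filter
          (fun x : Fin (i + 2) → X =>
            (∀ j : Fin (i + 1), x j.castSucc ∉ Y) ∧ x (Fin.last (i + 1)) ∈ Y),
        π (x 0) * ∏ j : Fin (i + 1), P (x j.castSucc) (x j.succ)

/-- The expected hitting time `τ = Σ_{j=1}^∞ (1 - Σ_{i=0}^{j-1} f(i))`, a value in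
`[0, ∞]`, of `Y` for the chain `P` started from `π`. -/
noncomputable def expHitTime {X : Type*} [Fintype X] [DecidableEq X]
    (P : X → X → ℝ) (π : X → ℝ) (Y : Finset X) : ℝ≥0∞ :=
  ∑' j : ℕ, ENNReal.ofReal (1 - ∑ i ∈ Finset.range (j + 1), hitDist P π Y i)

/-- The path weights of a stationary chain, summed against a function of the endpoint. -/
lemma sum_path_weight_of_stationary {X : Type*} [Fintype X] (P : X → X → ℝ) (π : X → ℝ)
    (hst : ∀ b, ∑ a, π a * P a b = π b) (g : X → ℝ) (i : ℕ) :
    ∑ x : Fin (i + 1) → X, π (x 0) * (∏ j : Fin i, P (x j.castSucc) (x j.succ)) *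
      g (x (Fin.last i)) = ∑ y, π y * g y := by
  induction i with
  | zero =>
    rw [← (Equiv.funUnique (Fin 1) X).symm.sum_comp]
    simp
  | succ i ih =>
    rw [← (Fin.consEquiv fun _ : Fin (i + 2) => X).sum_comp, Fintype.sum_prod_type,
      Finset.sum_comm, ← ih]
    refine Finset.sum_congr rfl fun x _ => ?_
    rw [← hst (x 0), Finset.sum_mul, Finset.sum_mul]
    refine Finset.sum_congr rfl fun a _ => ?_
    rw [Fin.prod_univ_succ, ← Fin.succ_last]
    simp only [Fin.consEquiv_apply, Fin.cons_zero, Fin.cons_succ, Fin.castSucc_zero,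
      ← Fin.succ_castSucc]
    ring

lemma hitDist_le_sum_of_stationary {X : Type*} [Fintype X] [DecidableEq X]
    (P : X → X → ℝ) (hP : ∀ a b, 0 ≤ P a b) (π : X → ℝ) (hπ : ∀ x, 0 ≤ π x)
    (hst : ∀ b, ∑ a, π a * P a b = π b) (Y : Finset X) (i : ℕ) :
    hitDist P π Y i ≤ ∑ y ∈ Y, π y := by
  cases i with
  | zero => exact le_rfl
  | succ i =>
    have key := sum_path_weight_of_stationary P π hst (fun y => if y ∈ Y then 1 else 0) (i + 1)
    simp only [mul_ite, mul_one, mul_zero, Finset.sum_ite_mem, Finset.univ_inter,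
      ← Finset.sum_filter] at key
    rw [hitDist, ← key]
    refine Finset.sum_le_sum_of_subset_of_nonneg ?_ fun x _ _ =>
      mul_nonneg (hπ _) (Finset.prod_nonneg fun _ _ => hP _ _)
    intro x hx
    simp only [Finset.mem_filter, Finset.mem_univ, true_and] at hx ⊢
    exact hx.2

lemma natCast_le_expHitTime {X : Type*} [Fintype X] [DecidableEq X]
    (P : X → X → ℝ) (hP : ∀ a b, 0 ≤ P a b) (π : X → ℝ) (hπ : ∀ x, 0 ≤ π x)
    (hst : ∀ b, ∑ a, π a * P a b = π b) (Y : Finset X) (T : ℕ)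
    (hY : (∑ y ∈ Y, π y) * (4 * T) ≤ 1) :
    (T : ℝ≥0∞) ≤ expHitTime P π Y := by
  have hp : 0 ≤ ∑ y ∈ Y, π y := Finset.sum_nonneg fun _ _ => hπ _
  have hterm : ∀ j ∈ Finset.range (2 * T), ENNReal.ofReal (1 / 2) ≤
      ENNReal.ofReal (1 - ∑ i ∈ Finset.range (j + 1), hitDist P π Y i) := by
    intro j hj
    apply ENNReal.ofReal_le_ofReal
    have hsum : ∑ i ∈ Finset.range (j + 1), hitDist P π Y i ≤ (j + 1 : ℕ) * ∑ y ∈ Y, π y := by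
      simpa using Finset.sum_le_card_nsmul (Finset.range (j + 1)) _ _ fun i _ =>
        hitDist_le_sum_of_stationary P hP π hπ hst Y i
    have hj' : ((j + 1 : ℕ) : ℝ) ≤ 2 * T := by
      exact_mod_cast Nat.succ_le_of_lt (Finset.mem_range.1 hj)
    have := mul_le_mul_of_nonneg_right hj' hp
    linarith
  calc (T : ℝ≥0∞) = ENNReal.ofReal (2 * T * (1 / 2)) := by
        rw [show (2 * T * (1 / 2) : ℝ) = T by ring, ENNReal.ofReal_natCast]
    _ = (2 * T : ℕ) * ENNReal.ofReal (1 / 2) := by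
        rw [ENNReal.ofReal_mul (by positivity)]
        congr 1
        rw [← ENNReal.ofReal_natCast]
        push_cast
        rfl
    _ = ∑ j ∈ Finset.range (2 * T), ENNReal.ofReal (1 / 2) := by simp
    _ ≤ _ := Finset.sum_le_sum hterm
    _ ≤ _ := ENNReal.sum_le_tsum _

/-- The set of edges obtained from a labelling of the vertices by `ι × Bool`, pairing the two
vertices whose labels share their first coordinate. -/
def pairingEdges {ι V : Type*} [Fintype ι] [DecidableEq V] (e : ι × Bool ≃ V) :
    Finset (Sym2 V) :=
  Finset.univ.image fun i => s(e (i, false), e (i, true))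

lemma isPerfectMatchingOn_pairingEdges {ι V : Type*} [Fintype ι] [DecidableEq V]
    (e : ι × Bool ≃ V) : IsPerfectMatchingOn (⊤ : SimpleGraph V) (pairingEdges e) := by
  constructor
  · intro z hz
    obtain ⟨i, -, rfl⟩ := Finset.mem_image.1 hz
    simp
  · intro v
    obtain ⟨⟨i, b⟩, rfl⟩ := e.surjective v
    refine ⟨s(e (i, false), e (i, true)), ⟨Finset.mem_image_of_mem _ (Finset.mem_univ i), ?_⟩, ?_⟩
    · cases b <;> simp
    · rintro z ⟨hz, hv⟩
      obtain ⟨j, -, rfl⟩ := Finset.mem_image.1 hz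
      have : i = j := by
        rcases Sym2.mem_iff.1 hv with h | h <;> exact congrArg Prod.fst (e.injective h)
      rw [this]

lemma card_filter_sym2Mk_mem_le {V : Type*} [Fintype V] [DecidableEq V] (E : Finset (Sym2 V)) :
    (Finset.univ.filter fun p : V × V => s(p.1, p.2) ∈ E).card ≤ 2 * E.card := by
  refine Finset.card_le_mul_card_image_of_maps_to (f := fun p : V × V => s(p.1, p.2))
    (fun p hp => (Finset.mem_filter.1 hp).2) 2 fun z _ => ?_
  induction z with
  | _ a b =>
    refine (Finset.card_le_card (t := {(a, b), (b, a)}) ?_).trans Finset.card_le_two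
    rintro ⟨x, y⟩ hp
    simpa using (Finset.mem_filter.1 hp).2

lemma card_filter_pairingEdges_subset_le {ι V : Type*} [Fintype ι] [DecidableEq ι] [Fintype V]
    [DecidableEq V] (E : Finset (Sym2 V)) :
    (Finset.univ.filter fun e : ι × Bool ≃ V => pairingEdges e ⊆ E).card ≤
      (2 * E.card) ^ Fintype.card ι := by
  calc _ ≤ (Fintype.piFinset fun _ : ι =>
          Finset.univ.filter fun p : V × V => s(p.1, p.2) ∈ E).card := by
        refine Finset.card_le_card_of_injOn (fun e i => (e (i, false), e (i, true))) ?_ ?_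
        · intro e he
          have he' : pairingEdges e ⊆ E := by simpa using he
          simpa using fun i => he' (Finset.mem_image_of_mem _ (Finset.mem_univ i))
        · intro e _ e' _ h
          ext ⟨i, b⟩
          have := congrFun h i
          cases b
          · exact congrArg Prod.fst this
          · exact congrArg Prod.snd this
    _ = (Finset.univ.filter fun p : V × V => s(p.1, p.2) ∈ E).card ^ Fintype.card ι := by simp
    _ ≤ _ := Nat.pow_le_pow_left (card_filter_sym2Mk_mem_le E) _

/-- If every state carries at most `m` edges, some perfect matching is contained in the edge sets
of a `π`-fraction of at most `(2 * m) ^ n / (2 * n)!` of the states. -/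
lemma exists_isPerfectMatchingOn_sum_le {X : Type*} [Fintype X] (π : X → ℝ) (hπ : ∀ x, 0 ≤ π x)
    (hsum : ∑ x, π x = 1) (n : ℕ) (ξ : X → Finset (Sym2 (Fin (2 * n)))) (m : ℝ)
    (hm : ∀ x, ((ξ x).card : ℝ) ≤ m) :
    ∃ M : Finset (Sym2 (Fin (2 * n))), IsPerfectMatchingOn (⊤ : SimpleGraph (Fin (2 * n))) M ∧
      (∑ x ∈ Finset.univ.filter (fun x => M ⊆ ξ x), π x) * (2 * n).factorial ≤ (2 * m) ^ n := by
  have hequiv : Fintype.card (Fin n × Bool) = Fintype.card (Fin (2 * n)) := by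
    simp [mul_comm]
  have hcard : Fintype.card (Fin n × Bool ≃ Fin (2 * n)) = (2 * n).factorial := by
    rw [Fintype.card_equiv (Fintype.equivOfCardEq hequiv), hequiv, Fintype.card_fin]
  have : Nonempty (Fin n × Bool ≃ Fin (2 * n)) := ⟨Fintype.equivOfCardEq hequiv⟩
  obtain ⟨e, -, he⟩ := Finset.exists_min_image
    (Finset.univ : Finset (Fin n × Bool ≃ Fin (2 * n)))
    (fun e => ∑ x ∈ Finset.univ.filter (fun x => pairingEdges e ⊆ ξ x), π x)
    Finset.univ_nonempty
  refine ⟨pairingEdges e, isPerfectMatchingOn_pairingEdges e, ?_⟩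
  calc _ ≤ ∑ e : Fin n × Bool ≃ Fin (2 * n),
          ∑ x ∈ Finset.univ.filter (fun x => pairingEdges e ⊆ ξ x), π x := by
        have := Finset.card_nsmul_le_sum _ _ _ he
        rwa [Finset.card_univ, hcard, nsmul_eq_mul, mul_comm] at this
    _ = ∑ x, (Finset.univ.filter fun e : Fin n × Bool ≃ Fin (2 * n) =>
          pairingEdges e ⊆ ξ x).card * π x := by
        simp_rw [Finset.sum_filter]
        rw [Finset.sum_comm]
        simp [← Finset.sum_filter]
    _ ≤ ∑ x, (2 * m) ^ n * π x := by
        refine Finset.sum_le_sum fun x _ => mul_le_mul_of_nonneg_right ?_ (hπ x)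
        have h := card_filter_pairingEdges_subset_le (ι := Fin n) (ξ x)
        rw [Fintype.card_fin] at h
        calc _ ≤ (((2 * (ξ x).card) ^ n : ℕ) : ℝ) := by exact_mod_cast h
          _ = (2 * ((ξ x).card : ℝ)) ^ n := by push_cast; rfl
          _ ≤ _ := by gcongr; exact hm x
    _ = _ := by rw [← Finset.mul_sum, hsum, mul_one]

open Filter Topology in
lemma eventually_pow_mul_le_factorial (c ε : ℝ) (hc : 0 < c) (hε : 0 < ε) (k : ℕ) :
    ∀ᶠ n : ℕ in atTop, (2 * (c * ((2 * n : ℕ) : ℝ) ^ (2 - ε))) ^ n * (4 * (n : ℝ) ^ k) ≤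
      ((2 * n).factorial : ℝ) := by
  have hlim : Tendsto (fun n : ℕ => 2 * c * Real.exp 2 * ((2 * n : ℕ) : ℝ) ^ (-ε)) atTop (𝓝 0) := by
    have h2 : Tendsto (fun n : ℕ => ((2 * n : ℕ) : ℝ)) atTop atTop :=
      tendsto_natCast_atTop_atTop.comp (tendsto_id.const_mul_atTop' two_pos)
    simpa using ((tendsto_rpow_neg_atTop hε).comp h2).const_mul (2 * c * Real.exp 2)
  have hpoly : Tendsto (fun n : ℕ => 4 * ((n : ℝ) ^ k * (1 / 2) ^ n)) atTop (𝓝 0) := by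
    simpa using (tendsto_pow_const_mul_const_pow_of_lt_one k (r := 1 / 2)
      (by norm_num) (by norm_num)).const_mul 4
  filter_upwards [hlim.eventually_le_const (show (0 : ℝ) < 1 / 2 by norm_num),
    hpoly.eventually_le_const one_pos, eventually_gt_atTop 0] with n h1 h2 hn
  have hpos : (0 : ℝ) < (2 * n : ℕ) := by positivity
  set t : ℝ := ((2 * n : ℕ) : ℝ) with ht
  have hfac : t ^ (2 * n) ≤ (2 * n).factorial * Real.exp t := by
    have := Real.pow_div_factorial_le_exp t hpos.le (2 * n)
    rwa [div_le_iff₀ (by positivity), mul_comm (Real.exp t)] at this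
  have hexp : Real.exp t = Real.exp 2 ^ n := by
    rw [← Real.exp_nat_mul, ht]
    push_cast
    ring_nf
  have hrpow : t ^ (2 - ε) = t ^ 2 * t ^ (-ε) := by
    rw [sub_eq_add_neg, Real.rpow_add hpos, Real.rpow_two]
  have he : 0 < Real.exp 2 ^ n := by positivity
  refine le_of_mul_le_mul_right ?_ he
  rw [← hexp]
  refine le_trans ?_ hfac
  calc (2 * (c * t ^ (2 - ε))) ^ n * (4 * (n : ℝ) ^ k) * Real.exp t
      = t ^ (2 * n) * ((2 * c * Real.exp 2 * t ^ (-ε)) ^ n * (4 * (n : ℝ) ^ k)) := by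
        rw [hexp, hrpow, pow_mul]
        simp only [mul_pow]
        ring
    _ ≤ t ^ (2 * n) * ((1 / 2) ^ n * (4 * (n : ℝ) ^ k)) := by
        gcongr
    _ ≤ t ^ (2 * n) * 1 := by
        gcongr
        linarith
    _ = _ := mul_one _

/-- For all real constants `c > 0` and `0 < ε < 2` and every `k : ℕ`, there is `N`
such that for all `n ≥ N`: for every nonempty finite set `X`, every row-stochastic
matrix `P` on `X` with stationary probability distribution `π`, and every assignment
`ξ` of at most `c·(2n)^{2-ε}` edges of the complete graph `K` on `2n` vertices to
each state, there is a perfect matching `M` of `K` whose associated set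
`Y = {x : M ⊆ ξ x}` has expected hitting time `τ ≥ n^k`. -/
theorem quantum_walk_limitation (c ε : ℝ) (hc : 0 < c) (hε : 0 < ε) (hε2 : ε < 2)
    (k : ℕ) :
    ∃ N : ℕ, ∀ n : ℕ, N ≤ n →
      ∀ (X : Type) [Fintype X] [DecidableEq X] [Nonempty X]
        (P : X → X → ℝ), (∀ a b, 0 ≤ P a b) → (∀ a, ∑ b, P a b = 1) →
      ∀ (π : X → ℝ), (∀ x, 0 ≤ π x) → (∑ x, π x = 1) →
        (∀ b, ∑ a, π a * P a b = π b) →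
      ∀ (ξ : X → Finset (Sym2 (Fin (2 * n)))),
        (∀ x, ∀ e ∈ ξ x, e ∈ (⊤ : SimpleGraph (Fin (2 * n))).edgeSet) →
        (∀ x, ((ξ x).card : ℝ) ≤ c * ((2 * n : ℕ) : ℝ) ^ (2 - ε)) →
      ∃ M : Finset (Sym2 (Fin (2 * n))),
        IsPerfectMatchingOn (⊤ : SimpleGraph (Fin (2 * n))) M ∧
        ((n : ℝ≥0∞)) ^ k ≤ expHitTime P π (Finset.univ.filter (fun x => M ⊆ ξ x)) := by
  obtain ⟨N, hN⟩ := Filter.eventually_atTop.1 (eventually_pow_mul_le_factorial c ε hc hε k)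
  refine ⟨N, fun n hn X _ _ _ P hP _ π hπ hsum hst ξ _ hcard => ?_⟩
  obtain ⟨M, hM, hle⟩ := exists_isPerfectMatchingOn_sum_le π hπ hsum n ξ _ hcard
  refine ⟨M, hM, ?_⟩
  rw [← Nat.cast_pow]
  refine natCast_le_expHitTime P hP π hπ hst _ _ ?_
  have hfac : (0 : ℝ) < (2 * n).factorial := by positivity
  refine le_of_mul_le_mul_right ?_ hfac
  rw [one_mul, mul_right_comm, Nat.cast_pow]
  exact (mul_le_mul_of_nonneg_right hle (by positivity)).trans (hN n hn)
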